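/- arXiv:2310.13033 — 4 statements merged into one kernel-verified Lean document; each statement's English description precedes it below -/
import Mathlib

section
/- For every real P > 0 and positive integers m ≤ n, there exist reals α, β > 0 with α + β = P such that (1 + m/α)(1 + n/β) ≤ 1 + (4/(m·snr))·(1 + 1/(n·snr)), where snr = P/(m·n). -/
/-- **Rank-1 power allocation bound.** For every real `P > 0` and positive integers
`m ≤ n`, there exist reals `α, β > 0` with `α + β = P` such that
`(1 + m/α) * (1 + n/β) ≤ 1 + (4/(m·snr)) * (1 + 1/(n·snr))`, where `snr = P/(m·n)`. -/
theorem rank_one_power_allocation (P : ℝ) (hP : 0 < P) (m n : ℕ)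
    (hm : 0 < m) (hmn : m ≤ n) :
    ∃ α β : ℝ, 0 < α ∧ 0 < β ∧ α + β = P ∧
      (1 + (m : ℝ) / α) * (1 + (n : ℝ) / β) ≤
        1 + 4 / ((m : ℝ) * (P / ((m : ℝ) * (n : ℝ)))) *
          (1 + 1 / ((n : ℝ) * (P / ((m : ℝ) * (n : ℝ))))) := by
  have hm' : (0 : ℝ) < m := by exact_mod_cast hm
  have hmn' : (m : ℝ) ≤ n := by exact_mod_cast hmn
  have hn' : (0 : ℝ) < n := hm'.trans_le hmn'
  refine ⟨P / 2, P / 2, by positivity, by positivity, by ring, ?_⟩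
  have hm_snr : (m : ℝ) * (P / (m * n)) = P / n := by field_simp
  have hn_snr : (n : ℝ) * (P / (m * n)) = P / m := by field_simp
  rw [hm_snr, hn_snr, ← sub_nonneg]
  have gap : 1 + 4 / (P / n) * (1 + 1 / (P / m)) - (1 + m / (P / 2)) * (1 + n / (P / 2))
      = 2 * ((n : ℝ) - m) / P := by
    field_simp
    ring
  rw [gap]
  exact div_nonneg (by linarith) hP.le
end

section
/- Let P > 0 be real and m ≤ n positive integers. Define α* = P/2 if m = n, and α* = sqrt(1 + P/n)·(sqrt(1 + P/m) − sqrt(1 + P/n))/((1/m) − (1/n)) if m < n, and set β* = P − α*. Then 0 < α* < P, and for all α, β > 0 with α + β = P one has (1 + m/α*)(1 + n/β*) ≤ (1 + m/α)(1 + n/β); that is, (α*, β*) minimizes f_P over the positive part of S_P. -/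
/-- On the line `α + β = P` the objective is a weighted sum of reciprocals. -/
theorem power_allocation_objective_eq {P m n α β : ℝ} (hP : P ≠ 0) (hm : m ≠ 0) (hn : n ≠ 0)
    (hα : α ≠ 0) (hβ : β ≠ 0) (h : α + β = P) :
    (1 + m / α) * (1 + n / β) =
      1 + m * n / P * ((1 + P / n) / α + (1 + P / m) / β) := by
  subst h
  field_simp
  ring

/-- Sedrakyan's inequality for two terms. -/
theorem add_sq_div_add_le_sq_div_add_sq_div {a b α β : ℝ} (hα : 0 < α) (hβ : 0 < β) :
    (b + a) ^ 2 / (α + β) ≤ b ^ 2 / α + a ^ 2 / β := by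
  rw [div_add_div _ _ hα.ne' hβ.ne', div_le_div_iff₀ (by positivity) (by positivity)]
  nlinarith [sq_nonneg (b * β - a * α)]


/-- **Explicit minimizer of the rank-1 power allocation problem.** For real `P > 0` and
positive integers `m ≤ n`, with `α* = P/2` if `m = n` and
`α* = √(1 + P/n)·(√(1 + P/m) − √(1 + P/n))/((1/m) − (1/n))` if `m < n`, and `β* = P − α*`,
one has `0 < α* < P` and `(1 + m/α*)(1 + n/β*) ≤ (1 + m/α)(1 + n/β)` for all
`α, β > 0` with `α + β = P`. -/
theorem rank_one_power_allocation_minimizer (P : ℝ) (hP : 0 < P) (m n : ℕ)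
    (hm : 0 < m) (hmn : m ≤ n)
    (αs : ℝ)
    (hαs : αs = if m = n then P / 2 else
      Real.sqrt (1 + P / (n : ℝ)) *
        ((Real.sqrt (1 + P / (m : ℝ)) - Real.sqrt (1 + P / (n : ℝ))) /
          (1 / (m : ℝ) - 1 / (n : ℝ))))
    (βs : ℝ) (hβs : βs = P - αs) :
    0 < αs ∧ αs < P ∧
      ∀ α β : ℝ, 0 < α → 0 < β → α + β = P →
        (1 + (m : ℝ) / αs) * (1 + (n : ℝ) / βs) ≤
          (1 + (m : ℝ) / α) * (1 + (n : ℝ) / β) := by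
  have hm0 : (0 : ℝ) < m := by exact_mod_cast hm
  have hn0 : (0 : ℝ) < n := by exact_mod_cast hm.trans_le hmn
  set a := Real.sqrt (1 + P / (m : ℝ)) with ha
  set b := Real.sqrt (1 + P / (n : ℝ)) with hb
  have ha0 : 0 < a := Real.sqrt_pos.2 (by positivity)
  have hb0 : 0 < b := Real.sqrt_pos.2 (by positivity)
  have ha2 : a ^ 2 = 1 + P / m := Real.sq_sqrt (by positivity)
  have hb2 : b ^ 2 = 1 + P / n := Real.sq_sqrt (by positivity)
  have hα : αs = P * b / (b + a) := by
    rw [hαs]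
    split_ifs with h
    · have hab : a = b := by rw [ha, hb, h]
      rw [hab]
      field_simp
      norm_num
    · have hlt : (m : ℝ) < n := by exact_mod_cast lt_of_le_of_ne hmn h
      have hd : 0 < 1 / (m : ℝ) - 1 / n := sub_pos.2 (one_div_lt_one_div_of_lt hm0 hlt)
      have key : (a - b) * (b + a) = P * (1 / (m : ℝ) - 1 / n) := by
        linear_combination ha2 - hb2
      rw [← mul_div_assoc, div_eq_div_iff hd.ne' (by positivity)]
      linear_combination b * key
  have hβ : βs = P * a / (b + a) := by
    rw [hβs, hα]
    field_simp
    ring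
  have hα0 : 0 < αs := by rw [hα]; positivity
  have hβ0 : 0 < βs := by rw [hβ]; positivity
  refine ⟨hα0, by linarith, fun α β h1 h2 h => ?_⟩
  rw [power_allocation_objective_eq hP.ne' hm0.ne' hn0.ne' hα0.ne' hβ0.ne' (by linarith),
    power_allocation_objective_eq hP.ne' hm0.ne' hn0.ne' h1.ne' h2.ne' h, ← ha2, ← hb2]
  have heq : b ^ 2 / αs + a ^ 2 / βs = (b + a) ^ 2 / (α + β) := by
    rw [hα, hβ, h]
    field_simp
  rw [heq]
  gcongr
  exact add_sq_div_add_le_sq_div_add_sq_div h1 h2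
end

section
/- Let m < n be positive integers, P > 0 real, snr = P/(m·n), and α* = sqrt(1 + P/n)·(sqrt(1 + P/m) − sqrt(1 + P/n))/((1/m) − (1/n)). Then 1 − 2α*/(m·n·snr) ≥ ((1 − m/n)/4)·(n·snr/(1 + n·snr)). -/
/-- **Key analytic estimate in the rank-1 power allocation bound.** For positive integers
`m < n`, real `P > 0`, `snr = P/(m·n)`, and
`α* = √(1 + P/n)·(√(1 + P/m) − √(1 + P/n))/((1/m) − (1/n))`, one has
`1 − 2α*/(m·n·snr) ≥ ((1 − m/n)/4)·(n·snr/(1 + n·snr))`. -/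
theorem rank_one_power_allocation_key_estimate (m n : ℕ) (P : ℝ)
    (hm : 0 < m) (hmn : m < n) (hP : 0 < P)
    (snr : ℝ) (hsnr : snr = P / ((m : ℝ) * (n : ℝ)))
    (αs : ℝ)
    (hαs : αs = Real.sqrt (1 + P / (n : ℝ)) *
        ((Real.sqrt (1 + P / (m : ℝ)) - Real.sqrt (1 + P / (n : ℝ))) /
          (1 / (m : ℝ) - 1 / (n : ℝ)))) :
    1 - 2 * αs / ((m : ℝ) * (n : ℝ) * snr) ≥
      (1 - (m : ℝ) / (n : ℝ)) / 4 * ((n : ℝ) * snr / (1 + (n : ℝ) * snr)) := by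
  have hm' : (0 : ℝ) < m := by exact_mod_cast hm
  have hmn' : (m : ℝ) < n := by exact_mod_cast hmn
  have hn' : (0 : ℝ) < n := hm'.trans hmn'
  have hy : 0 < P / (n : ℝ) := by positivity
  have hyx : P / (n : ℝ) < P / (m : ℝ) := div_lt_div_of_pos_left hP hm' hmn'
  have hB : 0 < √(1 + P / (n : ℝ)) := Real.sqrt_pos.2 (by linarith)
  have hBA : √(1 + P / (n : ℝ)) < √(1 + P / (m : ℝ)) :=
    Real.sqrt_lt_sqrt (by linarith) (by linarith)
  have hA2 : √(1 + P / (m : ℝ)) ^ 2 = 1 + P / (m : ℝ) := Real.sq_sqrt (by linarith)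
  have hB2 : √(1 + P / (n : ℝ)) ^ 2 = 1 + P / (n : ℝ) := Real.sq_sqrt (by linarith)
  have hmnsnr : (m : ℝ) * n * snr = P := by rw [hsnr]; field_simp
  have hnsnr : (n : ℝ) * snr = P / m := by rw [hsnr]; field_simp
  have hratio : (m : ℝ) / n = (P / n) / (P / m) := by field_simp
  have hgap : (1 : ℝ) / m - 1 / n = (P / m - P / n) / P := by field_simp
  rw [hmnsnr, hnsnr, hαs, hratio, hgap]
  generalize √(1 + P / (m : ℝ)) = A at *
  generalize √(1 + P / (n : ℝ)) = B at *
  generalize P / (m : ℝ) = x at *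
  generalize P / (n : ℝ) = y at *
  have hx : 0 < x := hy.trans hyx
  have hA : 0 < A := hB.trans hBA
  have hxy : x - y = (A - B) * (A + B) := by linarith
  have hAB : A - B ≠ 0 := (sub_pos.2 hBA).ne'
  have hlhs : 1 - 2 * (B * ((A - B) / ((x - y) / P))) / P = (x - y) / (A + B) ^ 2 := by
    rw [hxy]; field_simp; ring
  have hrhs : (1 - y / x) / 4 * (x / (1 + x)) = (x - y) / (2 * A) ^ 2 := by
    rw [mul_pow, hA2]; field_simp; norm_num
  rw [hlhs, hrhs, ge_iff_le]
  have hxy' : 0 ≤ x - y := by linarith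
  gcongr
  linarith
end

section
/- Let P > 0 be real, m ≤ n and r ≥ 1 positive integers, and κ_1, …, κ_r > 0 reals with κ_1 + ⋯ + κ_r = 1. Then there exist reals α_1, …, α_r, β_1, …, β_r > 0 with Σ_{i=1}^r (α_i + β_i) = P such that Σ_{i=1}^r κ_i (1 + m/α_i)(1 + n/β_i) ≤ 1 + (4r/(m·snr))·(1 + r/(n·snr)), where snr = P/(m·n). -/
open Finset in
/-- **Rank-r power allocation bound.** For real `P > 0`, positive integers `m ≤ n`, `r ≥ 1`,
and positive reals `κ_1, …, κ_r` summing to `1`, there exist positive reals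
`α_i, β_i` with `Σ_i (α_i + β_i) = P` such that
`Σ_i κ_i (1 + m/α_i)(1 + n/β_i) ≤ 1 + (4r/(m·snr))·(1 + r/(n·snr))`, where
`snr = P/(m·n)`. -/
theorem rank_r_power_allocation (P : ℝ) (hP : 0 < P) (m n r : ℕ)
    (hm : 0 < m) (hmn : m ≤ n) (hr : 1 ≤ r)
    (κ : Fin r → ℝ) (hκpos : ∀ i, 0 < κ i) (hκsum : ∑ i, κ i = 1)
    (snr : ℝ) (hsnr : snr = P / ((m : ℝ) * (n : ℝ))) :
    ∃ α β : Fin r → ℝ, (∀ i, 0 < α i) ∧ (∀ i, 0 < β i) ∧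
      (∑ i, (α i + β i)) = P ∧
      ∑ i, κ i * ((1 + (m : ℝ) / α i) * (1 + (n : ℝ) / β i)) ≤
        1 + 4 * (r : ℝ) / ((m : ℝ) * snr) * (1 + (r : ℝ) / ((n : ℝ) * snr)) := by
  have hm' : (0 : ℝ) < m := by exact_mod_cast hm
  have hmn' : (m : ℝ) ≤ n := by exact_mod_cast hmn
  have hn' : (0 : ℝ) < n := hm'.trans_le hmn'
  have hr' : (0 : ℝ) < r := by exact_mod_cast hr
  refine ⟨fun _ => P / (2 * r), fun _ => P / (2 * r), fun _ => by positivity,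
    fun _ => by positivity, ?_, ?_⟩
  · rw [sum_const, card_univ, Fintype.card_fin, nsmul_eq_mul]
    field_simp
    norm_num
  · rw [← sum_mul, hκsum, one_mul, hsnr]
    have hgap : 1 + 4 * (r : ℝ) / (m * (P / (m * n))) * (1 + r / (n * (P / (m * n))))
        - (1 + m / (P / (2 * r))) * (1 + n / (P / (2 * r))) = 2 * r * (n - m) / P := by
      field_simp
      ring
    have hnonneg : 0 ≤ 2 * (r : ℝ) * (n - m) / P :=
      div_nonneg (mul_nonneg (by positivity) (sub_nonneg.2 hmn')) hP.le
    linarith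
end
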